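/- arXiv:1802.05809 — 5 statements merged into one kernel-verified Lean document; each statement's English description precedes it below -/
import Mathlib

section
/- Assume the eikonal setting: Ω : ℝ × ℝ → ℝ is a C¹ function of (t,ξ) with partial derivatives Ω_t, Ω_ξ; s ∈ {−1,1} and κ ∈ ℝ are fixed; φ : ℝ × ℝ → ℝ is a C² function of (x,t) satisfying φ_t(x,t) = s·Ω(t, κ − φ_x(x,t)) for all (x,t). Let x : ℝ → ℝ be differentiable with x'(t) = s·Ω_ξ(t, κ − φ_x(x(t),t)) for all t. Then the function t ↦ φ_x(x(t), t) is constant. -/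
theorem hasDerivAt_partial_fst {f : ℝ × ℝ → ℝ} {x t : ℝ} (hf : DifferentiableAt ℝ f (x, t)) :
    HasDerivAt (fun y => f (y, t)) (fderiv ℝ f (x, t) (1, 0)) x :=
  hf.hasFDerivAt.comp_hasDerivAt x ((hasDerivAt_id x).prodMk (hasDerivAt_const x t))

theorem hasDerivAt_partial_snd {f : ℝ × ℝ → ℝ} {x t : ℝ} (hf : DifferentiableAt ℝ f (x, t)) :
    HasDerivAt (fun y => f (x, y)) (fderiv ℝ f (x, t) (0, 1)) t :=
  hf.hasFDerivAt.comp_hasDerivAt t ((hasDerivAt_const t x).prodMk (hasDerivAt_id t))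

/-- Lemma 3.3, part 1: along a characteristic `x'(t) = s·Ω_ξ(t, κ − φ_x(x(t),t))`
of the eikonal equation `φ_t = s·Ω(t, κ − φ_x)`, the function `t ↦ φ_x(x(t),t)` is constant. -/
theorem stmt_3
    (Ω : ℝ → ℝ → ℝ) (hΩ : ContDiff ℝ 1 (fun p : ℝ × ℝ => Ω p.1 p.2))
    (s : ℝ) (hs : s = 1 ∨ s = -1) (κ : ℝ)
    (φ : ℝ → ℝ → ℝ) (hφ : ContDiff ℝ 2 (fun p : ℝ × ℝ => φ p.1 p.2))
    (heik : ∀ x t : ℝ, deriv (fun t' => φ x t') t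
      = s * Ω t (κ - deriv (fun x' => φ x' t) x))
    (X : ℝ → ℝ)
    (hX : ∀ t : ℝ, HasDerivAt X
      (s * deriv (fun ξ => Ω t ξ) (κ - deriv (fun x' => φ x' t) (X t))) t) :
    ∀ t₁ t₂ : ℝ,
      deriv (fun x' => φ x' t₁) (X t₁) = deriv (fun x' => φ x' t₂) (X t₂) := by
  set F : ℝ × ℝ → ℝ := fun p => φ p.1 p.2 with hF
  have hFd : Differentiable ℝ F := hφ.differentiable (by norm_num)
  have hDd : Differentiable ℝ (fderiv ℝ F) :=
    (hφ.fderiv_right (m := 1) (by norm_num)).differentiable (by norm_num)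
  have hx (x t : ℝ) : deriv (fun x' => φ x' t) x = fderiv ℝ F (x, t) (1, 0) :=
    (hasDerivAt_partial_fst (hFd (x, t))).deriv
  have ht (x t : ℝ) : deriv (fun t' => φ x t') t = fderiv ℝ F (x, t) (0, 1) :=
    (hasDerivAt_partial_snd (hFd (x, t))).deriv
  simp only [hx, ht] at heik hX ⊢
  have hsymm (p v w : ℝ × ℝ) :
      fderiv ℝ (fderiv ℝ F) p v w = fderiv ℝ (fderiv ℝ F) p w v :=
    (hφ.contDiffAt.isSymmSndFDerivAt (by simp)).eq v w
  have hΩξ (t ξ : ℝ) : HasDerivAt (fun ξ => Ω t ξ) (deriv (fun ξ => Ω t ξ) ξ) ξ :=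
    (hasDerivAt_partial_snd
      (hΩ.differentiable (by norm_num) (t, ξ))).differentiableAt.hasDerivAt
  have hline (v : ℝ × ℝ) (x t : ℝ) : HasDerivAt (fun y => fderiv ℝ F (y, t) v)
      (fderiv ℝ (fderiv ℝ F) (x, t) (1, 0) v) x := by
    have h := (hDd (x, t)).hasFDerivAt.comp_hasDerivAt x
      ((hasDerivAt_id x).prodMk (hasDerivAt_const x t))
    simpa using h.clm_apply (hasDerivAt_const x v)
  have hmixed (x t : ℝ) : fderiv ℝ (fderiv ℝ F) (x, t) (1, 0) (0, 1) =
      s * (deriv (fun ξ => Ω t ξ) (κ - fderiv ℝ F (x, t) (1, 0)) *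
        -fderiv ℝ (fderiv ℝ F) (x, t) (1, 0) (1, 0)) := by
    have h := ((hΩξ t _).comp x ((hline (1, 0) x t).const_sub κ)).const_mul s
    refine (hline (0, 1) x t).unique (h.congr_of_eventuallyEq ?_)
    exact Filter.Eventually.of_forall fun y => heik y t
  have hconst (t : ℝ) : HasDerivAt (fun r => fderiv ℝ F (X r, r) (1, 0)) 0 t := by
    have h := HasFDerivAt.comp_hasDerivAt (f := fun r => (X r, r)) t
      (hDd (X t, t)).hasFDerivAt ((hX t).prodMk (hasDerivAt_id t))
    have h' := h.clm_apply (hasDerivAt_const t ((1, 0) : ℝ × ℝ))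
    refine h'.congr_deriv ?_
    set c := s * deriv (fun ξ => Ω t ξ) (κ - fderiv ℝ F (X t, t) (1, 0)) with hc
    have hsplit : ((c, 1) : ℝ × ℝ) = c • (1, 0) + (0, 1) := by simp
    rw [hsplit, map_add, map_smul, map_zero, add_zero, add_apply, smul_apply,
      hsymm _ (0, 1) (1, 0), hmixed, smul_eq_mul, hc]
    ring
  exact is_const_of_deriv_eq_zero (fun t => (hconst t).differentiableAt)
    (fun t => (hconst t).deriv)
end

section
/- Assume: Ω : ℝ × ℝ → ℝ is a C¹ function of (t,ξ) with partial derivative Ω_ξ in the second argument; s ∈ {−1,1}; φ : ℝ³ → ℝ is a C² function of (x,t,κ) satisfying the eikonal equation ∂_tφ(x,t,κ) = s·Ω(t, κ − ∂_xφ(x,t,κ)) for all (x,t,κ). Let κ̂ : ℝ × ℝ → ℝ be differentiable and satisfy the stationary-phase equation ∂_κφ(x,t,κ̂(x,t)) = x for all (x,t), and suppose ∂_κ∂_κφ(x,t,κ̂(x,t)) ≠ 0 for all (x,t). Then for all (x,t): ∂_tκ̂(x,t) + s·Ω_ξ(t, κ̂(x,t) − ∂_xφ(x,t,κ̂(x,t)))·∂_xκ̂(x,t)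 = 0. -/
/-- A directional derivative of a `C²` function, differentiated along a curve. -/
theorem hasDerivAt_fderiv_apply_comp {E : Type*} [NormedAddCommGroup E] [NormedSpace ℝ E]
    {F : E → ℝ} (hF : ContDiff ℝ 2 F) {γ : ℝ → E} {γ' : E} {u : ℝ} (hγ : HasDerivAt γ γ' u)
    (v : E) :
    HasDerivAt (fun r => fderiv ℝ F (γ r) v) (fderiv ℝ (fderiv ℝ F) (γ u) γ' v) u := by
  have h1 : ContDiff ℝ 1 (fderiv ℝ F) := hF.fderiv_right (by norm_num)
  have h2 := ((h1.differentiable (by norm_num)) (γ u)).hasFDerivAt.comp_hasDerivAt u hγ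
  simpa using h2.clm_apply (hasDerivAt_const u v)

/-- transport law (59) for the local quasimomentum: if `φ(x,t,κ)` solves the
eikonal equation `∂_tφ = s·Ω(t, κ − ∂_xφ)` and the local quasimomentum `κ̂(x,t)` is determined
by the stationary-phase condition `∂_κφ(x,t,κ̂(x,t)) = x` with `∂_κ∂_κφ ≠ 0`, then
`∂_tκ̂ + s·Ω_ξ(t, κ̂ − ∂_xφ)·∂_xκ̂ = 0`. -/
theorem stmt_9
    (Ω : ℝ → ℝ → ℝ) (hΩ : ContDiff ℝ 1 (fun p : ℝ × ℝ => Ω p.1 p.2))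
    (s : ℝ) (hs : s = 1 ∨ s = -1)
    (φ : ℝ → ℝ → ℝ → ℝ)
    (hφ : ContDiff ℝ 2 (fun p : ℝ × ℝ × ℝ => φ p.1 p.2.1 p.2.2))
    (heik : ∀ x t κ : ℝ, deriv (fun t' => φ x t' κ) t
      = s * Ω t (κ - deriv (fun x' => φ x' t κ) x))
    (K : ℝ → ℝ → ℝ) (hK : Differentiable ℝ (fun p : ℝ × ℝ => K p.1 p.2))
    (hstat : ∀ x t : ℝ, deriv (fun κ' => φ x t κ') (K x t) = x)
    (hnd : ∀ x t : ℝ,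
      deriv (fun κ' => deriv (fun κ'' => φ x t κ'') κ') (K x t) ≠ 0) :
    ∀ x t : ℝ,
      deriv (fun t' => K x t') t
        + s * deriv (fun ξ => Ω t ξ) (K x t - deriv (fun x' => φ x' t (K x t)) x)
            * deriv (fun x' => K x' t) x = 0 := by
  intro x t
  set F : ℝ × ℝ × ℝ → ℝ := fun p => φ p.1 p.2.1 p.2.2 with hFdef
  have hF1 : ∀ p, HasFDerivAt F (fderiv ℝ F p) p := fun p =>
    (hφ.differentiable (by norm_num) p).hasFDerivAt
  have cx : ∀ a b c : ℝ, HasDerivAt (fun r : ℝ => (r, b, c)) ((1, 0, 0) : ℝ × ℝ × ℝ) a :=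
    fun a b c => (hasDerivAt_id a).prodMk ((hasDerivAt_const a b).prodMk (hasDerivAt_const a c))
  have ct : ∀ a b c : ℝ, HasDerivAt (fun r : ℝ => (a, r, c)) ((0, 1, 0) : ℝ × ℝ × ℝ) b :=
    fun a b c => (hasDerivAt_const b a).prodMk ((hasDerivAt_id b).prodMk (hasDerivAt_const b c))
  have ck : ∀ a b c : ℝ, HasDerivAt (fun r : ℝ => (a, b, r)) ((0, 0, 1) : ℝ × ℝ × ℝ) c :=
    fun a b c => (hasDerivAt_const c a).prodMk ((hasDerivAt_const c b).prodMk (hasDerivAt_id c))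
  have dx : ∀ a b c : ℝ, deriv (fun r => φ r b c) a = fderiv ℝ F (a, b, c) (1, 0, 0) :=
    fun a b c => by
      have h := (hF1 (a, b, c)).comp_hasDerivAt a (cx a b c)
      exact h.deriv
  have dt : ∀ a b c : ℝ, deriv (fun r => φ a r c) b = fderiv ℝ F (a, b, c) (0, 1, 0) :=
    fun a b c => by
      have h := (hF1 (a, b, c)).comp_hasDerivAt b (ct a b c)
      exact h.deriv
  have dk : ∀ a b c : ℝ, deriv (fun r => φ a b r) c = fderiv ℝ F (a, b, c) (0, 0, 1) :=
    fun a b c => by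
      have h := (hF1 (a, b, c)).comp_hasDerivAt c (ck a b c)
      exact h.deriv
  have hsymm : ∀ p v w, fderiv ℝ (fderiv ℝ F) p v w = fderiv ℝ (fderiv ℝ F) p w v := fun p v w =>
    (hφ.contDiffAt.isSymmSndFDerivAt (by simp)).eq v w
  simp only [dx, dt, dk] at heik hstat hnd ⊢
  have hKx : HasDerivAt (fun r => K r t) (deriv (fun r => K r t) x) x := by
    have h := (hK (x, t)).hasFDerivAt.comp_hasDerivAt x
      ((hasDerivAt_id x).prodMk (hasDerivAt_const x t))
    exact h.differentiableAt.hasDerivAt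
  have hKt : HasDerivAt (fun r => K x r) (deriv (fun r => K x r) t) t := by
    have h := (hK (x, t)).hasFDerivAt.comp_hasDerivAt t
      ((hasDerivAt_const t x).prodMk (hasDerivAt_id t))
    exact h.differentiableAt.hasDerivAt
  set Kx := deriv (fun r => K r t) x
  set Kt := deriv (fun r => K x r) t
  set B := fderiv ℝ (fderiv ℝ F) (x, t, K x t)
  have hkk := (hasDerivAt_fderiv_apply_comp hφ (ck x t (K x t)) (0, 0, 1)).deriv
  have hnd' := hnd x t
  rw [hkk] at hnd'
  have ex : B (1, 0, Kx) (0, 0, 1) = 1 := by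
    have h := hasDerivAt_fderiv_apply_comp hφ
      ((hasDerivAt_id x).prodMk ((hasDerivAt_const x t).prodMk hKx)) (0, 0, 1)
    simp only [id, hstat] at h
    exact h.unique (hasDerivAt_id x)
  have et : B (0, 1, Kt) (0, 0, 1) = 0 := by
    have h := hasDerivAt_fderiv_apply_comp hφ
      ((hasDerivAt_const t x).prodMk ((hasDerivAt_id t).prodMk hKt)) (0, 0, 1)
    simp only [id, hstat] at h
    exact h.unique (hasDerivAt_const t x)
  have hΩξ : ∀ ξ : ℝ, HasDerivAt (fun r => Ω t r) (deriv (fun r => Ω t r) ξ) ξ := fun ξ => by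
    have h := (hΩ.differentiable (by norm_num) (t, ξ)).hasFDerivAt.comp_hasDerivAt ξ
      ((hasDerivAt_const ξ t).prodMk (hasDerivAt_id ξ))
    exact h.differentiableAt.hasDerivAt
  have ek := hasDerivAt_fderiv_apply_comp hφ (ck x t (K x t)) (0, 1, 0)
  simp only [heik] at ek
  have ek' := ek.unique (((hΩξ _).comp (K x t) ((hasDerivAt_id (K x t)).sub
    (hasDerivAt_fderiv_apply_comp hφ (ck x t (K x t)) (1, 0, 0)))).const_mul s)
  have vx : ((1, 0, Kx) : ℝ × ℝ × ℝ) = (1, 0, 0) + Kx • (0, 0, 1) := by simp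
  have vt : ((0, 1, Kt) : ℝ × ℝ × ℝ) = (0, 1, 0) + Kt • (0, 0, 1) := by simp
  rw [vx, map_add, map_smul] at ex
  rw [vt, map_add, map_smul] at et
  simp only [add_apply, smul_apply, smul_eq_mul] at ex et
  rw [hsymm _ (0, 0, 1) (0, 1, 0), hsymm _ (0, 0, 1) (1, 0, 0)] at ek'
  simp only [id, Pi.sub_apply] at ek'
  apply mul_left_cancel₀ hnd'
  set Ωξ := deriv (fun r => Ω t r) (K x t - fderiv ℝ F (x, t, K x t) (1, 0, 0))
  linear_combination et - ek' + s * Ωξ * ex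
end

section
/- Let h ∈ (0,1) and a₂ > 0, and define f : ℝ → ℝ by f(Ω) := cos(Ω(1−h)/√a₂) − (Ωh/(2√a₂))·sin(Ω(1−h)/√a₂). Then there exists a natural number N such that for every integer n ≥ N and every κ ∈ [−π, π] there is exactly one Ω ∈ ℝ with Ω(1−h)/√a₂ ∈ [nπ − 1, nπ + 1] satisfying f(Ω) = cos κ. -/
theorem hasDerivAt_cos_sub_mul_sin (c M t : ℝ) :
    HasDerivAt (fun t : ℝ => Real.cos t - c * (M + t) * Real.sin t)
      (-Real.sin t - (c * Real.sin t + c * (M + t) * Real.cos t)) t := by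
  have hlin : HasDerivAt (fun t : ℝ => c * (M + t)) c t := by
    simpa using ((hasDerivAt_id t).const_add M).const_mul c
  exact (Real.hasDerivAt_cos t).sub (hlin.mul (Real.hasDerivAt_sin t))

theorem strictAntiOn_cos_sub_mul_sin {c M : ℝ} (hc : 0 < c) (hM : 4 + 4 * c ≤ c * (M - 1)) :
    StrictAntiOn (fun t : ℝ => Real.cos t - c * (M + t) * Real.sin t) (Set.Icc (-1) 1) := by
  refine strictAntiOn_of_deriv_neg (convex_Icc _ _)
    (fun t _ => (hasDerivAt_cos_sub_mul_sin c M t).continuousAt.continuousWithinAt) ?_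
  intro t ht
  rw [interior_Icc] at ht
  obtain ⟨ht₁, ht₂⟩ := ht
  rw [(hasDerivAt_cos_sub_mul_sin c M t).deriv]
  have hcos : 1 / 2 ≤ Real.cos t := by
    nlinarith [Real.one_sub_sq_div_two_le_cos (x := t)]
  have hsin : -((1 + c) * Real.sin t) ≤ 1 + c := by
    nlinarith [Real.neg_one_le_sin t]
  have hlin : 4 + 4 * c ≤ c * (M + t) := by nlinarith
  nlinarith [mul_le_mul hlin hcos (by norm_num) (by linarith)]

theorem existsUnique_cos_sub_mul_sin_eq {c M d : ℝ} (hc : 0 < c)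
    (hM : 4 + 4 * c ≤ c * (M - 1)) (hd : d ∈ Set.Icc (-1 : ℝ) 1) :
    ∃! t : ℝ, t ∈ Set.Icc (-1 : ℝ) 1 ∧ Real.cos t - c * (M + t) * Real.sin t = d := by
  have hsin : 1 / 2 ≤ Real.sin 1 := by
    linarith [Real.sin_gt_sub_cube one_pos]
  have hcos : 0 ≤ Real.cos 1 := Real.cos_one_pos.le
  have hleft : d ≤ Real.cos (-1) - c * (M + -1) * Real.sin (-1) := by
    rw [Real.cos_neg, Real.sin_neg]
    nlinarith [hd.2]
  have hright : Real.cos 1 - c * (M + 1) * Real.sin 1 ≤ d := by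
    nlinarith [hd.1, Real.cos_le_one 1]
  obtain ⟨t, ht, hteq⟩ := intermediate_value_Icc' (by norm_num : (-1 : ℝ) ≤ 1)
    (fun t _ => (hasDerivAt_cos_sub_mul_sin c M t).continuousAt.continuousWithinAt)
    ⟨hright, hleft⟩
  exact ⟨t, ⟨ht, hteq⟩, fun s hs =>
    (strictAntiOn_cos_sub_mul_sin hc hM).injOn hs.1 ht (hs.2.trans hteq.symm)⟩

/-- for the limit dispersion function
`f(Ω) = cos(Ω(1−h)/√a₂) − (Ωh/(2√a₂))·sin(Ω(1−h)/√a₂)` of a high-contrast periodic medium,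
there is `N` such that for every `n ≥ N` and every `κ ∈ [−π,π]` there is exactly one `Ω`
with `Ω(1−h)/√a₂ ∈ [nπ−1, nπ+1]` satisfying the dispersion relation `f(Ω) = cos κ`. -/
theorem stmt_16
    (h a₂ : ℝ) (hh : h ∈ Set.Ioo (0 : ℝ) 1) (ha₂ : 0 < a₂)
    (f : ℝ → ℝ)
    (hf : ∀ Ω : ℝ, f Ω = Real.cos (Ω * (1 - h) / Real.sqrt a₂)
      - (Ω * h / (2 * Real.sqrt a₂)) * Real.sin (Ω * (1 - h) / Real.sqrt a₂)) :
    ∃ N : ℕ, ∀ n : ℕ, N ≤ n → ∀ κ ∈ Set.Icc (-Real.pi) Real.pi,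
      ∃! Ω : ℝ,
        Ω * (1 - h) / Real.sqrt a₂
            ∈ Set.Icc ((n : ℝ) * Real.pi - 1) ((n : ℝ) * Real.pi + 1)
          ∧ f Ω = Real.cos κ := by
  obtain ⟨hh₀, hh₁⟩ := hh
  have hs : 0 < Real.sqrt a₂ := Real.sqrt_pos.2 ha₂
  have h1 : 0 < 1 - h := sub_pos.2 hh₁
  obtain ⟨c, hcdef⟩ : ∃ c, c = h / (2 * (1 - h)) := ⟨_, rfl⟩
  have hc : 0 < c := by rw [hcdef]; positivity
  obtain ⟨N, hN⟩ := exists_nat_ge ((4 + 4 * c) / c + 1)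
  refine ⟨N, fun n hn κ _ => ?_⟩
  have hM : 4 + 4 * c ≤ c * ((n : ℝ) * Real.pi - 1) := by
    have hNn : (N : ℝ) ≤ n := Nat.cast_le.2 hn
    have hpi : (n : ℝ) ≤ n * Real.pi :=
      le_mul_of_one_le_right n.cast_nonneg (by linarith [Real.pi_gt_three])
    rw [← div_le_iff₀' hc]
    linarith
  have hsq : ((-1 : ℝ) ^ n) * (-1) ^ n = 1 := by rw [← mul_pow]; norm_num
  have hd : (-1 : ℝ) ^ n * Real.cos κ ∈ Set.Icc (-1 : ℝ) 1 := by
    rw [Set.mem_Icc, ← abs_le, abs_mul, abs_neg_one_pow, one_mul]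
    exact Real.abs_cos_le_one κ
  have hfeq : ∀ Ω t : ℝ, Ω * (1 - h) / Real.sqrt a₂ = t + n * Real.pi →
      f Ω = (-1) ^ n * (Real.cos t - c * (n * Real.pi + t) * Real.sin t) := by
    intro Ω t hΩ
    have hcoeff : Ω * h / (2 * Real.sqrt a₂) = c * (n * Real.pi + t) := by
      rw [add_comm, ← hΩ, hcdef]
      field_simp
    rw [hf, hcoeff, hΩ, Real.cos_add_nat_mul_pi, Real.sin_add_nat_mul_pi]
    ring
  obtain ⟨t, ⟨ht, hteq⟩, huniq⟩ := existsUnique_cos_sub_mul_sin_eq hc hM hd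
  have hΩ : (t + n * Real.pi) * Real.sqrt a₂ / (1 - h) * (1 - h) / Real.sqrt a₂
      = t + n * Real.pi := by field_simp
  refine ⟨(t + n * Real.pi) * Real.sqrt a₂ / (1 - h), ⟨?_, ?_⟩, ?_⟩
  · rw [hΩ]
    constructor <;> linarith [ht.1, ht.2]
  · rw [hfeq _ t hΩ, hteq, ← mul_assoc, hsq, one_mul]
  · rintro Ω ⟨hmem, hval⟩
    have hts : Ω * (1 - h) / Real.sqrt a₂ - n * Real.pi = t := by
      refine huniq _ ⟨⟨by linarith [hmem.1], by linarith [hmem.2]⟩, ?_⟩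
      rw [← hval, hfeq Ω _ (sub_add_cancel _ _).symm, ← mul_assoc, hsq, one_mul]
    rw [← hts, sub_add_cancel]
    field_simp
end

section
/- Let h ∈ (0,1) and a₂ > 0, and define f : ℝ → ℝ by f(Ω) := cos(Ω(1−h)/√a₂) − (Ωh/(2√a₂))·sin(Ω(1−h)/√a₂). Then there exists a constant C > 0 such that for every integer n ≥ 1, every κ ∈ [−π, π], and every Ω ∈ ℝ with Ω(1−h)/√a₂ ∈ [nπ − 1, nπ + 1] and f(Ω) = cos κ, one has |Ω − [√a₂·nπ/(1−h) + (2√a₂/(nπh))·(1 + (−1)^{n+1}·cos κ)]| ≤ C/n². -/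
theorem abs_sub_sin_le_abs_cube_div_four {x : ℝ} (hx : |x| ≤ 1) :
    |x - Real.sin x| ≤ |x| ^ 3 / 4 := by
  have hb := Real.sin_bound hx
  have htri : |x - Real.sin x| ≤ |x ^ 3 / 6| + |Real.sin x - (x - x ^ 3 / 6)| := by
    rw [show x - Real.sin x = x ^ 3 / 6 - (Real.sin x - (x - x ^ 3 / 6)) by ring]
    exact abs_sub _ _
  rw [abs_div, abs_pow, abs_of_pos (by norm_num : (0 : ℝ) < 6)] at htri
  have hpow : |x| ^ 5 ≤ |x| ^ 3 := pow_le_pow_of_le_one (abs_nonneg x) hx (by norm_num)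
  have hnonneg : 0 ≤ |x| ^ 3 := by positivity
  linarith

/-- First-order asymptotics, as `n → ∞`, of the small solutions `δ` of
`(nπ + δ) sin δ = k (cos δ - c)`. -/
theorem abs_sub_le_of_mul_sin_eq {k c δ n : ℝ} (hk : 0 < k) (hc : |c| ≤ 1) (hδ : |δ| ≤ 1)
    (hn : 1 ≤ n) (heq : (n * Real.pi + δ) * Real.sin δ = k * (Real.cos δ - c)) :
    |δ - k / (n * Real.pi) * (1 - c)| ≤ 4 * k ^ 2 * (2 + k) / n ^ 2 := by
  have hπ := Real.pi_gt_three
  have hn0 : 0 < n := by linarith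
  have hnπ : 1 ≤ n * Real.pi := by nlinarith
  have hnπ0 : 0 < n * Real.pi := by linarith
  have hx : 2 * n ≤ n * Real.pi + δ := by nlinarith [neg_abs_le δ]
  have hsub := abs_sub_sin_le_abs_cube_div_four hδ
  have hcube : |δ| ^ 3 ≤ |δ| := pow_le_of_le_one (abs_nonneg δ) hδ (by norm_num)
  have hcube_sq : |δ| ^ 3 ≤ δ ^ 2 := by
    rw [← sq_abs δ]
    exact pow_le_pow_of_le_one (abs_nonneg δ) hδ (by norm_num)
  have hsin : 2 * n * |Real.sin δ| ≤ 2 * k := by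
    calc 2 * n * |Real.sin δ| ≤ (n * Real.pi + δ) * |Real.sin δ| := by gcongr
      _ = k * |Real.cos δ - c| := by
        rw [← abs_of_pos (show 0 < n * Real.pi + δ by linarith), ← abs_mul, heq, abs_mul,
          abs_of_pos hk]
      _ ≤ k * 2 := by
        gcongr
        linarith [abs_sub (Real.cos δ) c, Real.abs_cos_le_one δ]
      _ = 2 * k := by ring
  have hδn : |δ| ≤ 2 * k / n := by
    have hδsin : |δ| ≤ 2 * |Real.sin δ| := by
      linarith [abs_sub_abs_le_abs_sub δ (Real.sin δ), abs_nonneg δ]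
    rw [le_div_iff₀ hn0]
    nlinarith
  have hδsq : δ ^ 2 ≤ 4 * k ^ 2 / n ^ 2 := by
    calc δ ^ 2 = |δ| ^ 2 := (sq_abs δ).symm
      _ ≤ (2 * k / n) ^ 2 := by gcongr
      _ = 4 * k ^ 2 / n ^ 2 := by ring
  have hscaled : n * Real.pi * (δ - k / (n * Real.pi) * (1 - c))
      = n * Real.pi * (δ - Real.sin δ) - δ * Real.sin δ - k * (1 - Real.cos δ) := by
    have hcancel : n * Real.pi * (k / (n * Real.pi)) = k := by field_simp
    linear_combination heq - (1 - c) * hcancel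
  have h₁ : |n * Real.pi * (δ - Real.sin δ)| ≤ n * Real.pi * δ ^ 2 := by
    rw [abs_mul, abs_of_pos hnπ0]
    gcongr
    linarith [sq_nonneg δ]
  have h₂ : |δ * Real.sin δ| ≤ δ ^ 2 := by
    rw [abs_mul, ← sq_abs δ, sq]
    exact mul_le_mul_of_nonneg_left Real.abs_sin_le_abs (abs_nonneg δ)
  have h₃ : |k * (1 - Real.cos δ)| ≤ k * δ ^ 2 := by
    rw [abs_mul, abs_of_pos hk, abs_of_nonneg (by linarith [Real.cos_le_one δ])]
    gcongr
    linarith [Real.one_sub_sq_div_two_le_cos (x := δ), sq_nonneg δ]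
  have hmul : n * Real.pi * |δ - k / (n * Real.pi) * (1 - c)|
      ≤ n * Real.pi * ((2 + k) * δ ^ 2) := by
    rw [← abs_of_pos hnπ0, ← abs_mul, abs_of_pos hnπ0, hscaled]
    have htri₁ := abs_sub (n * Real.pi * (δ - Real.sin δ) - δ * Real.sin δ)
      (k * (1 - Real.cos δ))
    have htri₂ := abs_sub (n * Real.pi * (δ - Real.sin δ)) (δ * Real.sin δ)
    have hextra : (1 + k) * δ ^ 2 ≤ n * Real.pi * ((1 + k) * δ ^ 2) :=
      le_mul_of_one_le_left (by positivity) hnπ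
    linarith
  calc |δ - k / (n * Real.pi) * (1 - c)| ≤ (2 + k) * δ ^ 2 := le_of_mul_le_mul_left hmul hnπ0
    _ ≤ (2 + k) * (4 * k ^ 2 / n ^ 2) := by gcongr
    _ = 4 * k ^ 2 * (2 + k) / n ^ 2 := by ring


/-- asymptotics of the `n`-th branch of the high-contrast dispersion relation:
any solution `Ω` of `f(Ω) = cos κ` in the window `Ω(1−h)/√a₂ ∈ [nπ−1, nπ+1]` satisfies
`Ω = √a₂·nπ/(1−h) + (2√a₂/(nπh))·(1+(−1)^{n+1}cos κ) + O(1/n²)`, with a uniform remainder. -/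
theorem stmt_17
    (h a₂ : ℝ) (hh : h ∈ Set.Ioo (0 : ℝ) 1) (ha₂ : 0 < a₂)
    (f : ℝ → ℝ)
    (hf : ∀ Ω : ℝ, f Ω = Real.cos (Ω * (1 - h) / Real.sqrt a₂)
      - (Ω * h / (2 * Real.sqrt a₂)) * Real.sin (Ω * (1 - h) / Real.sqrt a₂)) :
    ∃ C : ℝ, 0 < C ∧ ∀ n : ℕ, 1 ≤ n → ∀ κ ∈ Set.Icc (-Real.pi) Real.pi, ∀ Ω : ℝ,
      Ω * (1 - h) / Real.sqrt a₂
          ∈ Set.Icc ((n : ℝ) * Real.pi - 1) ((n : ℝ) * Real.pi + 1) →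
      f Ω = Real.cos κ →
      |Ω - (Real.sqrt a₂ * (n : ℝ) * Real.pi / (1 - h)
          + (2 * Real.sqrt a₂ / ((n : ℝ) * Real.pi * h))
            * (1 + (-1 : ℝ) ^ (n + 1) * Real.cos κ))| ≤ C / (n : ℝ) ^ 2 := by
  obtain ⟨h0, h1⟩ := hh
  have hs : 0 < Real.sqrt a₂ := Real.sqrt_pos.mpr ha₂
  set s := Real.sqrt a₂
  have h1' : 0 < 1 - h := by linarith
  set k := 2 * (1 - h) / h with hk
  have hkpos : 0 < k := by positivity
  refine ⟨s / (1 - h) * (4 * k ^ 2 * (2 + k)), by positivity, ?_⟩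
  intro n hn κ _ Ω hΩ hfΩ
  have hn1 : (1 : ℝ) ≤ n := by exact_mod_cast hn
  have hn0 : (n : ℝ) ≠ 0 := by positivity
  obtain ⟨δ, hδ⟩ : ∃ δ, Ω * (1 - h) / s = n * Real.pi + δ :=
    ⟨Ω * (1 - h) / s - n * Real.pi, by ring⟩
  have hΩδ : Ω = s / (1 - h) * (n * Real.pi + δ) := by
    rw [← hδ]
    field_simp
  rw [hδ] at hΩ
  have hδ1 : |δ| ≤ 1 := abs_le.mpr ⟨by linarith [hΩ.1], by linarith [hΩ.2]⟩
  have hsign : ((-1 : ℝ) ^ n) * (-1) ^ n = 1 := by rw [← mul_pow]; norm_num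
  have hc : |(-1 : ℝ) ^ n * Real.cos κ| ≤ 1 := by
    rw [abs_mul, abs_neg_one_pow, one_mul]
    exact Real.abs_cos_le_one κ
  have hdisp : Real.cos δ - (n * Real.pi + δ) / k * Real.sin δ = (-1) ^ n * Real.cos κ := by
    have hcoeff : Ω * h / (2 * s) = (n * Real.pi + δ) / k := by
      rw [hΩδ, hk]
      field_simp
    rw [hf, hcoeff, hδ, add_comm (n * Real.pi) δ, Real.cos_add_nat_mul_pi,
      Real.sin_add_nat_mul_pi] at hfΩ
    rw [← hfΩ]
    linear_combination
      -(Real.cos δ - (n * Real.pi + δ) / k * Real.sin δ) * hsign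
  have heq : (n * Real.pi + δ) * Real.sin δ
      = k * (Real.cos δ - (-1) ^ n * Real.cos κ) := by
    rw [← hdisp]
    field_simp
    ring
  have hmain := abs_sub_le_of_mul_sin_eq hkpos hc hδ1 hn1 heq
  have herror : Ω - (s * n * Real.pi / (1 - h)
      + (2 * s / (n * Real.pi * h)) * (1 + (-1 : ℝ) ^ (n + 1) * Real.cos κ))
      = s / (1 - h) * (δ - k / (n * Real.pi) * (1 - (-1) ^ n * Real.cos κ)) := by
    rw [hΩδ, hk, pow_succ]
    field_simp
    ring
  rw [herror, abs_mul, abs_of_pos (by positivity : 0 < s / (1 - h)), mul_div_assoc]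
  gcongr
end

section
/- Let h ∈ (0,1) and a₂ > 0, and define f : ℝ → ℝ by f(Ω) := cos(Ω(1−h)/√a₂) − (Ωh/(2√a₂))·sin(Ω(1−h)/√a₂). Then there exist a constant C > 0 and a natural number N such that for every integer n ≥ N the following holds: if Ω : [−π, π] → ℝ is differentiable with f(Ω(κ)) = cos κ and Ω(κ)(1−h)/√a₂ ∈ [nπ − 1, nπ + 1] for all κ ∈ [−π, π], then for every κ ∈ [−π, π]: |Ω'(κ) − (−1)ⁿ·(2√a₂/(nπh))·sin κ| ≤ C/n². -/
/-- If `y = mπ + d` with `|d| ≤ 1` and `|cos d - b y sin d| ≤ 1`, then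
`(1 + b) sin d + b y cos d` is bounded below by `b m / 2` and differs from `b m π` by a bounded
amount. -/
lemma dispersion_slope_bounds {b m d : ℝ} (hb : 0 < b) (hm : 1 ≤ m)
    (hbm : 2 * (1 + b) ≤ b * m) (hd : |d| ≤ 1)
    (h : |Real.cos d - b * (m * Real.pi + d) * Real.sin d| ≤ 1) :
    b * m / 2 ≤ (1 + b) * Real.sin d + b * (m * Real.pi + d) * Real.cos d ∧
      |b * m * Real.pi - ((1 + b) * Real.sin d + b * (m * Real.pi + d) * Real.cos d)|
        ≤ 2 * b + 3 := by
  have hpi := Real.pi_gt_three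
  obtain ⟨hd1, hd2⟩ := abs_le.mp hd
  have hcos : 1 / 2 ≤ Real.cos d := by
    have := Real.one_sub_sq_div_two_le_cos (x := d)
    nlinarith
  have hcos1 := Real.cos_le_one d
  have hsin1 := Real.sin_le_one d
  have hsin2 := Real.neg_one_le_sin d
  have hsq := Real.sin_sq_add_cos_sq d
  obtain ⟨y, hy⟩ : ∃ y, y = m * Real.pi + d := ⟨_, rfl⟩
  have hy2 : 2 * m ≤ y := by nlinarith
  rw [← hy] at h ⊢
  have hby : 2 * (b * m) ≤ b * y := by nlinarith
  obtain ⟨h1, h2⟩ := abs_le.mp h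
  have hs : |b * y * Real.sin d| ≤ 2 := abs_le.mpr ⟨by linarith, by linarith⟩
  have hbys : b * y * (Real.sin d) ^ 2 ≤ 2 := by
    calc b * y * (Real.sin d) ^ 2 ≤ |b * y * Real.sin d * Real.sin d| := by
          rw [pow_two, ← mul_assoc]; exact le_abs_self _
      _ = |b * y * Real.sin d| * |Real.sin d| := abs_mul _ _
      _ ≤ 2 * 1 := mul_le_mul hs (Real.abs_sin_le_one d) (abs_nonneg _) (by norm_num)
      _ = 2 := by norm_num
  have hbm0 : 0 < b * m := by positivity
  have hc : b * y * (1 - Real.cos d) ≤ 2 := by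
    refine le_trans (mul_le_mul_of_nonneg_left ?_ (by linarith)) hbys
    nlinarith
  have hc0 : 0 ≤ b * y * (1 - Real.cos d) := mul_nonneg (by linarith) (by linarith)
  have hyd : b * y = b * m * Real.pi + b * d := by rw [hy]; ring
  have hbs : b * Real.sin d ≤ b := by nlinarith
  have hbs' : -b ≤ b * Real.sin d := by nlinarith
  have hbd : b * d ≤ b := by nlinarith
  have hbd' : -b ≤ b * d := by nlinarith
  refine ⟨?_, abs_le.mpr ⟨?_, ?_⟩⟩
  · have : b * y * (1 / 2) ≤ b * y * Real.cos d :=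
      mul_le_mul_of_nonneg_left hcos (by linarith)
    linarith
  · linarith
  · linarith

/-- Differentiating `cos (c Ω) - b c Ω sin (c Ω) = cos κ` along a differentiable branch. -/
lemma derivWithin_dispersion_branch {b c : ℝ} {Ω : ℝ → ℝ} {s : Set ℝ} {κ : ℝ}
    (hs : UniqueDiffWithinAt ℝ s κ) (hκ : κ ∈ s) (hΩ : DifferentiableWithinAt ℝ Ω s κ)
    (h : ∀ k ∈ s, Real.cos (c * Ω k) - b * (c * Ω k) * Real.sin (c * Ω k) = Real.cos k) :
    c * derivWithin Ω s κ *
        ((1 + b) * Real.sin (c * Ω κ) + b * (c * Ω κ) * Real.cos (c * Ω κ))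
      = Real.sin κ := by
  have hx : HasDerivWithinAt (fun k => c * Ω k) (c * derivWithin Ω s κ) s κ :=
    hΩ.hasDerivWithinAt.const_mul c
  have hl := hx.cos.sub ((hx.const_mul b).mul hx.sin)
  have hr : HasDerivWithinAt Real.cos (-Real.sin κ) s κ :=
    (Real.hasDerivAt_cos κ).hasDerivWithinAt
  have hl' := hl.congr (f₁ := Real.cos) (fun k hk => (h k hk).symm) (h κ hκ).symm
  have := hs.eq_deriv _ hl' hr
  linarith

/-- asymptotics of the group velocity on the `n`-th branch of the high-contrast
dispersion relation: if `Ω : [−π,π] → ℝ` is differentiable with `f(Ω(κ)) = cos κ` and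
`Ω(κ)(1−h)/√a₂ ∈ [nπ−1, nπ+1]`, then
`Ω'(κ) = (−1)ⁿ·(2√a₂/(nπh))·sin κ + O(1/n²)`, with a uniform remainder. -/
theorem stmt_18
    (h a₂ : ℝ) (hh : h ∈ Set.Ioo (0 : ℝ) 1) (ha₂ : 0 < a₂)
    (f : ℝ → ℝ)
    (hf : ∀ Ω : ℝ, f Ω = Real.cos (Ω * (1 - h) / Real.sqrt a₂)
      - (Ω * h / (2 * Real.sqrt a₂)) * Real.sin (Ω * (1 - h) / Real.sqrt a₂)) :
    ∃ C : ℝ, 0 < C ∧ ∃ N : ℕ, ∀ n : ℕ, N ≤ n →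
      ∀ Ω : ℝ → ℝ,
        DifferentiableOn ℝ Ω (Set.Icc (-Real.pi) Real.pi) →
        (∀ κ ∈ Set.Icc (-Real.pi) Real.pi,
          f (Ω κ) = Real.cos κ
          ∧ Ω κ * (1 - h) / Real.sqrt a₂
              ∈ Set.Icc ((n : ℝ) * Real.pi - 1) ((n : ℝ) * Real.pi + 1)) →
        ∀ κ ∈ Set.Icc (-Real.pi) Real.pi,
          |derivWithin Ω (Set.Icc (-Real.pi) Real.pi) κ
              - (-1 : ℝ) ^ n * (2 * Real.sqrt a₂ / ((n : ℝ) * Real.pi * h)) * Real.sin κ|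
            ≤ C / (n : ℝ) ^ 2 := by
  obtain ⟨h0, h1⟩ := hh
  have hr : 0 < Real.sqrt a₂ := Real.sqrt_pos.mpr ha₂
  set r := Real.sqrt a₂
  have h1' : 0 < 1 - h := by linarith
  obtain ⟨b, hb⟩ : ∃ b, b = h / (2 * (1 - h)) := ⟨_, rfl⟩
  obtain ⟨c, hc⟩ : ∃ c, c = (1 - h) / r := ⟨_, rfl⟩
  have hb0 : 0 < b := by rw [hb]; positivity
  have hc0 : 0 < c := by rw [hc]; positivity
  obtain ⟨N, hN⟩ := exists_nat_ge (2 * (1 + b) / b)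
  refine ⟨2 * (2 * b + 3) / (b ^ 2 * c), by positivity, N + 1, ?_⟩
  intro n hn Ω hΩ hbr κ hκ
  have hm : (1 : ℝ) ≤ n := by exact_mod_cast (by omega : 1 ≤ n)
  have hNn : (N : ℝ) ≤ n := by exact_mod_cast (by omega : N ≤ n)
  have hbm : 2 * (1 + b) ≤ b * n := by
    have := (div_le_iff₀ hb0).mp (hN.trans hNn)
    linarith
  have hphase : ∀ k, Ω k * (1 - h) / r = c * Ω k := fun k => by rw [hc]; ring
  have hrel : ∀ k ∈ Set.Icc (-Real.pi) Real.pi,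
      Real.cos (c * Ω k) - b * (c * Ω k) * Real.sin (c * Ω k) = Real.cos k := by
    intro k hk
    rw [← (hbr k hk).1, hf, hphase]
    congr 2
    rw [hb, hc]
    field_simp
  have hder := derivWithin_dispersion_branch
    (uniqueDiffOn_Icc (by linarith [Real.pi_pos]) κ hκ) hκ (hΩ κ hκ) hrel
  have hmem := (hbr κ hκ).2
  rw [hphase] at hmem
  have hrelκ := hrel κ hκ
  obtain ⟨d, hd⟩ : ∃ d, d = c * Ω κ - n * Real.pi := ⟨_, rfl⟩
  have hy : c * Ω κ = n * Real.pi + d := by rw [hd]; ring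
  have hd1 : |d| ≤ 1 := abs_le.mpr ⟨by linarith [hmem.1], by linarith [hmem.2]⟩
  have hcosd : Real.cos (n * Real.pi + d) = (-1) ^ n * Real.cos d := by
    rw [add_comm, Real.cos_add_nat_mul_pi]
  have hsind : Real.sin (n * Real.pi + d) = (-1) ^ n * Real.sin d := by
    rw [add_comm, Real.sin_add_nat_mul_pi]
  rw [hy, hcosd, hsind] at hrelκ hder
  have hε : |(-1 : ℝ) ^ n| = 1 := by simp
  have hεε : (-1 : ℝ) ^ n * (-1) ^ n = 1 := by rw [← mul_pow]; simp
  have hle : |Real.cos d - b * (n * Real.pi + d) * Real.sin d| ≤ 1 := by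
    calc |Real.cos d - b * (n * Real.pi + d) * Real.sin d|
        = |(-1 : ℝ) ^ n * (Real.cos d - b * (n * Real.pi + d) * Real.sin d)| := by
          rw [abs_mul, hε, one_mul]
      _ = |Real.cos κ| := by rw [← hrelκ]; congr 1; ring
      _ ≤ 1 := Real.abs_cos_le_one κ
  obtain ⟨hD, hdiff⟩ := dispersion_slope_bounds hb0 hm hbm hd1 hle
  obtain ⟨D, hDdef⟩ : ∃ D, D = (1 + b) * Real.sin d + b * (n * Real.pi + d) * Real.cos d :=
    ⟨_, rfl⟩
  rw [← hDdef] at hD hdiff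
  have hn0 : (0 : ℝ) < n := by linarith
  have hbn : 0 < b * n := by positivity
  have hD0 : 0 < D := by linarith
  have hpi := Real.pi_gt_three
  have hderD : c * derivWithin Ω (Set.Icc (-Real.pi) Real.pi) κ * D
      = (-1) ^ n * Real.sin κ := by
    rw [← hder, hDdef]
    linear_combination (-(c * derivWithin Ω (Set.Icc (-Real.pi) Real.pi) κ *
      ((1 + b) * Real.sin d + b * (n * Real.pi + d) * Real.cos d))) * hεε
  have hΩ' : derivWithin Ω (Set.Icc (-Real.pi) Real.pi) κ
      = (-1) ^ n * Real.sin κ / (c * D) := by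
    rw [eq_div_iff (by positivity), ← hderD]; ring
  have hlead : 2 * r / (n * Real.pi * h) = 1 / (c * (b * n * Real.pi)) := by
    rw [hb, hc]; field_simp
  have hsplit : derivWithin Ω (Set.Icc (-Real.pi) Real.pi) κ
      - (-1 : ℝ) ^ n * (2 * r / (n * Real.pi * h)) * Real.sin κ
      = (-1) ^ n * Real.sin κ * ((b * n * Real.pi - D) / (c * D * (b * n * Real.pi))) := by
    rw [hΩ', hlead]; field_simp
  have hden : c * (b * n / 2) * (b * n) ≤ c * D * (b * n * Real.pi) := by
    have hbnπ : b * n ≤ b * n * Real.pi := le_mul_of_one_le_right hbn.le (by linarith)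
    exact mul_le_mul (mul_le_mul_of_nonneg_left hD hc0.le) hbnπ hbn.le (by positivity)
  have hden0 : 0 < c * D * (b * n * Real.pi) := by positivity
  rw [hsplit, abs_mul, abs_mul, hε, one_mul, abs_div, abs_of_pos hden0]
  calc |Real.sin κ| * (|b * n * Real.pi - D| / (c * D * (b * n * Real.pi)))
      ≤ 1 * ((2 * b + 3) / (c * (b * n / 2) * (b * n))) := by
        gcongr
        exact Real.abs_sin_le_one κ
    _ = 2 * (2 * b + 3) / (b ^ 2 * c) / (n : ℝ) ^ 2 := by field_simp
end
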